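/- In the QuickSort run space (Q_n, q_n), for all 1 ≤ i < j ≤ n the probability that the elements of ranks i and j are compared during the run equals 2/(j - i + 1); here the elements of ranks i and j are compared exactly when one of them is the first element chosen as a splitter among the elements of ranks i, i+1, ..., j, so this probability is q_n(E_n(i,i,j) ∪ E_n(j,i,j)) and the two events E_n(i,i,j) and E_n(j,i,j) are disjoint. -/

import Mathlib

/-- Runs of QuickSort, encoded as trees: `node k a b` is a run whose first
splitter has rank `k` (within the current input), with recursive runs `a` on
the `k - 1` smaller elements and `b` on the remaining larger elements. -/
inductive Run : Type where
  | leaf : Run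
  | node : ℕ → Run → Run → Run
deriving DecidableEq

/-- The sample space `Q n` of runs of QuickSort on `n` elements:
`Q 0 = Q 1 = {⊥}` and, for `n ≥ 2`,
`Q n = ⋃_{k ∈ {1,…,n}} {k} × (Q (k-1) × Q (n-k))`. -/
def runs : ℕ → Finset Run
  | 0 => {Run.leaf}
  | 1 => {Run.leaf}
  | n + 2 =>
    (Finset.univ : Finset (Fin (n + 2))).biUnion fun k =>
      ((runs k.val) ×ˢ (runs (n + 1 - k.val))).image fun p =>
        Run.node (k.val + 1) p.1 p.2
decreasing_by
  · exact k.isLt.trans_le (Nat.le_refl _)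
  · omega

/-- The probability `q n` of a run of QuickSort on `n` elements:
`q n ⊥ = 1` and `q n (k, (a, b)) = (1 / n) * q (k - 1) a * q (n - k) b`. -/
noncomputable def qv : ℕ → Run → ℝ
  | _, Run.leaf => 1
  | n, Run.node k a b => (1 / (n : ℝ)) * qv (k - 1) a * qv (n - k) b

/-- The number of comparisons `t n` of a run of QuickSort on `n` elements:
`t n ⊥ = 0` and `t n (k, (a, b)) = (n - 1) + t (k - 1) a + t (n - k) b`. -/
noncomputable def tv : ℕ → Run → ℝ
  | _, Run.leaf => 0
  | n, Run.node k a b => ((n : ℝ) - 1) + tv (k - 1) a + tv (n - k) b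
/-- The event `E n (q, i, j)` ("the element of rank `q` is the first one chosen
as a splitter among the elements of ranks `i, …, j`"), decided recursively on
the run `(k, (a, b))`: if `i ≤ k ≤ j`, membership holds iff `k = q`; if
`k > j`, membership is decided in the left subrun `a` (an event of
`Q (k - 1)`); if `k < i`, membership is decided in the right subrun `b` with
all ranks shifted down by `k` (an event of `Q (n - k)`). -/
def inEvent (q i j : ℕ) : Run → Bool
  | Run.leaf => false
  | Run.node k a b =>
    if i ≤ k ∧ k ≤ j then k == q
    else if j < k then inEvent q i j a
    else inEvent (q - k) (i - k) (j - k) b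

open Finset

theorem sum_runs_add_two {M : Type*} [AddCommMonoid M] (n : ℕ) (f : Run → M) :
    ∑ x ∈ runs (n + 2), f x =
      ∑ k ∈ range (n + 2), ∑ a ∈ runs k, ∑ b ∈ runs (n + 1 - k), f (Run.node (k + 1) a b) := by
  rw [runs, sum_biUnion]
  · rw [← Fin.sum_univ_eq_sum_range
      (fun k => ∑ a ∈ runs k, ∑ b ∈ runs (n + 1 - k), f (Run.node (k + 1) a b))]
    refine sum_congr rfl fun k _ => ?_
    rw [sum_image, sum_product]
    rintro ⟨a, b⟩ - ⟨c, d⟩ - h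
    simpa using h
  · intro k _ l _ hkl
    simp only [Function.onFun, disjoint_left, mem_image, not_exists, not_and]
    rintro _ ⟨p, _, rfl⟩ p' _ h
    simp only [Run.node.injEq, Nat.add_right_cancel_iff] at h
    exact hkl (Fin.ext h.1.symm)

theorem qv_node_add_two (n k : ℕ) (a b : Run) :
    qv (n + 2) (Run.node (k + 1) a b) = 1 / ((n + 2 : ℕ) : ℝ) * (qv k a * qv (n + 1 - k) b) := by
  rw [qv, Nat.add_sub_cancel, show n + 2 - (k + 1) = n + 1 - k by omega, mul_assoc]

theorem sum_qv_runs (n : ℕ) : ∑ x ∈ runs n, qv n x = 1 := by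
  induction n using Nat.strong_induction_on with
  | _ n ih =>
    match n with
    | 0 => simp [runs, qv]
    | 1 => simp [runs, qv]
    | n + 2 =>
      have h : ∀ k ∈ range (n + 2), ∑ a ∈ runs k, ∑ b ∈ runs (n + 1 - k),
          qv (n + 2) (Run.node (k + 1) a b) = 1 / ((n + 2 : ℕ) : ℝ) := by
        intro k hk
        simp only [qv_node_add_two, ← mul_sum]
        rw [ih (n + 1 - k) (by omega)]
        simp only [mul_one]
        rw [ih k (mem_range.1 hk), mul_one]
      rw [sum_runs_add_two, sum_congr rfl h, sum_const, card_range, nsmul_eq_mul]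
      field_simp

theorem sum_qv_inEvent (n q i j : ℕ) (hi : 1 ≤ i) (hiq : i ≤ q) (hqj : q ≤ j) (hij : i < j)
    (hjn : j ≤ n) :
    ∑ x ∈ runs n, (if inEvent q i j x = true then qv n x else 0) = 1 / ((j : ℝ) - i + 1) := by
  induction n using Nat.strong_induction_on generalizing q i j with
  | _ n ih =>
    obtain ⟨n, rfl⟩ : ∃ m, n = m + 2 := ⟨n - 2, by omega⟩
    have hpos : (0 : ℝ) < (j : ℝ) - i + 1 := by
      have : (i : ℝ) < j := by exact_mod_cast hij
      linarith
    set c : ℝ := 1 / ((j : ℝ) - i + 1) with hc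
    have h : ∀ k ∈ range (n + 2), ∑ a ∈ runs k, ∑ b ∈ runs (n + 1 - k),
        (if inEvent q i j (Run.node (k + 1) a b) = true
          then qv (n + 2) (Run.node (k + 1) a b) else 0) =
        1 / ((n + 2 : ℕ) : ℝ) *
          (c + ((if k = q - 1 then 1 else 0) - if k ∈ Ico (i - 1) j then c else 0)) := by
      intro k hk
      have hk' := mem_range.1 hk
      simp only [qv_node_add_two, inEvent, mem_Ico]
      by_cases h1 : i ≤ k + 1 ∧ k + 1 ≤ j
      · have h2 : i - 1 ≤ k ∧ k < j := by omega
        simp only [h1, h2, and_self, if_true, beq_iff_eq]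
        by_cases h3 : k + 1 = q
        · have h4 : k = q - 1 := by omega
          simp only [h3, if_true, ← mul_sum, sum_qv_runs, mul_one]
          simp [h4]
        · have h4 : k ≠ q - 1 := by omega
          simp [h3, h4]
      · have h2 : ¬ (i - 1 ≤ k ∧ k < j) := by omega
        have h4 : k ≠ q - 1 := by omega
        simp only [h1, h2, h4, if_false, sub_zero, add_zero]
        by_cases h5 : j < k + 1
        · simp only [h5, if_true]
          have := ih k hk' q i j hi hiq hqj hij (by omega)
          rw [← hc] at this
          rw [← this, mul_sum]
          refine sum_congr rfl fun a _ => ?_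
          split_ifs
          · simp only [← mul_sum, sum_qv_runs, mul_one]
          · simp
        · simp only [h5, if_false]
          have := ih (n + 1 - k) (by omega) (q - (k + 1)) (i - (k + 1)) (j - (k + 1))
            (by omega) (by omega) (by omega) (by omega) (by omega)
          rw [Nat.cast_sub (by omega : k + 1 ≤ j), Nat.cast_sub (by omega : k + 1 ≤ i),
            sub_sub_sub_cancel_right, ← hc] at this
          have h6 : ∀ a ∈ runs k, ∑ b ∈ runs (n + 1 - k),
              (if inEvent (q - (k + 1)) (i - (k + 1)) (j - (k + 1)) b = true
                then 1 / ((n + 2 : ℕ) : ℝ) * (qv k a * qv (n + 1 - k) b) else 0) =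
              1 / ((n + 2 : ℕ) : ℝ) * (qv k a * c) := by
            intro a _
            rw [← this, mul_sum, mul_sum]
            exact sum_congr rfl fun b _ => by split_ifs <;> simp
          rw [sum_congr rfl h6, ← mul_sum, ← sum_mul, sum_qv_runs, one_mul]
    have hsub : (range (n + 2)).filter (· ∈ Ico (i - 1) j) = Ico (i - 1) j := by
      ext k
      simp only [mem_filter, mem_range, mem_Ico]
      omega
    rw [sum_runs_add_two, sum_congr rfl h, ← mul_sum, sum_add_distrib, sum_sub_distrib,
      sum_ite_eq', if_pos (mem_range.2 (by omega)), ← sum_filter, hsub, sum_const, sum_const,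
      card_range, Nat.card_Ico, nsmul_eq_mul, nsmul_eq_mul,
      Nat.cast_sub (by omega : i - 1 ≤ j), Nat.cast_sub hi]
    have h7 : ((j : ℝ) - ((i : ℝ) - (1 : ℕ))) * c = 1 := by
      rw [hc, Nat.cast_one]
      field_simp
      ring
    rw [h7]
    field_simp
    ring

theorem inEvent_unique {q q' i j : ℕ} {r : Run} (hiq : i ≤ q) (hiq' : i ≤ q')
    (h : inEvent q i j r = true) (h' : inEvent q' i j r = true) : q = q' := by
  induction r generalizing q q' i j with
  | leaf => simp [inEvent] at h
  | node k a b iha ihb =>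
    rw [inEvent] at h h'
    split_ifs at h h' with h1 h2
    · simp only [beq_iff_eq] at h h'
      omega
    · exact iha hiq hiq' h h'
    · have := ihb (by omega) (by omega) h h'
      omega

/-- In the QuickSort run space `(Q n, q n)`, for all
`1 ≤ i < j ≤ n`, the events `E n (i, i, j)` and `E n (j, i, j)` are disjoint
and the probability that the elements of ranks `i` and `j` are compared, i.e.
`q n (E n (i, i, j) ∪ E n (j, i, j))`, equals `2 / (j - i + 1)`. -/
theorem ranks_compared_probability (n i j : ℕ)
    (hi : 1 ≤ i) (hij : i < j) (hjn : j ≤ n) :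
    Disjoint ((runs n).filter fun r => inEvent i i j r = true)
             ((runs n).filter fun r => inEvent j i j r = true) ∧
    ∑ x ∈ (runs n).filter
        (fun r => inEvent i i j r = true ∨ inEvent j i j r = true), qv n x
      = 2 / ((j : ℝ) - (i : ℝ) + 1) := by
  have hd : Disjoint ((runs n).filter fun r => inEvent i i j r = true)
      ((runs n).filter fun r => inEvent j i j r = true) := by
    rw [disjoint_filter]
    intro r _ h h'
    exact hij.ne (inEvent_unique le_rfl hij.le h h')
  refine ⟨hd, ?_⟩
  rw [filter_or, sum_union hd, sum_filter, sum_filter,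
    sum_qv_inEvent n i i j hi le_rfl hij.le hij hjn,
    sum_qv_inEvent n j i j hi hij.le le_rfl hij hjn]
  ring
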